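/- Let r ≥ 2 and n ≥ r be integers, and let G be a simple graph with n vertices and m edges, where m ≥ t_r(n). Then every 𝔓-sequence v_1, …, v_r of r terms in G satisfies Σ_{i=1}^{r} d(v_i) ≥ 2·r·m/n. -/

import Mathlib

open Finset

/-- The number of edges of a simple graph. -/
noncomputable def edgeCount {V : Type*} (G : SimpleGraph V) : ℕ := Nat.card G.edgeSet

/-- The degree of a vertex. -/
noncomputable def deg {V : Type*} (G : SimpleGraph V) (u : V) : ℕ := Nat.card (G.neighborSet u)

/-- The number of edges `t_r(n)` of the Turán graph `T_r(n)`. -/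
noncomputable def turanEdges (r n : ℕ) : ℕ := edgeCount (SimpleGraph.turanGraph n r)

/-- `v 0, ..., v (k-1)` is a 𝔓-sequence in `G`: each `v i` lies in the common
neighbourhood of the previous terms and has maximum degree among the vertices of
that common neighbourhood (for `i = 0`, the common neighbourhood is the whole
vertex set, so `v 0` is a vertex of maximum degree in `G`). -/
def IsPSeq {V : Type*} (G : SimpleGraph V) {k : ℕ} (v : Fin k → V) : Prop :=
  ∀ i : Fin k,
    (∀ j : Fin k, j < i → G.Adj (v j) (v i)) ∧
    ∀ u : V, (∀ j : Fin k, j < i → G.Adj (v j) u) → deg G u ≤ deg G (v i)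

/-- A sum of integers between prescribed bounds can take every value between the extreme ones. -/
lemma exists_between_sum_eq {ι : Type*} (s : Finset ι) (a e : ι → ℤ) (hae : ∀ i, a i ≤ e i)
    (N : ℤ) (haN : ∑ i ∈ s, a i ≤ N) (hNe : N ≤ ∑ i ∈ s, e i) :
    ∃ c : ι → ℤ, (∀ i, a i ≤ c i) ∧ (∀ i, c i ≤ e i) ∧ ∑ i ∈ s, c i = N := by
  classical
  induction s using Finset.induction_on generalizing N with
  | empty => exact ⟨a, fun _ => le_rfl, hae, by simp at *; omega⟩
  | insert x s hx ih =>
    rw [sum_insert hx] at haN hNe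
    have hx' := hae x
    obtain ⟨y, h₁, h₂, h₃, h₄⟩ : ∃ y, a x ≤ y ∧ y ≤ e x ∧ ∑ i ∈ s, a i ≤ N - y ∧
        N - y ≤ ∑ i ∈ s, e i := by
      refine ⟨max (a x) (N - ∑ i ∈ s, e i), ?_⟩
      have := sum_le_sum fun i (_ : i ∈ s) => hae i
      omega
    obtain ⟨c, hac, hce, hc⟩ := ih _ h₃ h₄
    refine ⟨Function.update c x y, fun i => ?_, fun i => ?_, ?_⟩
    · by_cases h : i = x
      · subst h; simpa
      · simpa [h] using hac i
    · by_cases h : i = x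
      · subst h; simpa
      · simpa [h] using hce i
    · rw [sum_insert hx, sum_update_of_notMem hx, hc]
      simp

lemma edgeCount_eq_card_edgeFinset {V : Type*} [Fintype V] (G : SimpleGraph V)
    [DecidableRel G.Adj] [Fintype G.edgeSet] : edgeCount G = #G.edgeFinset := by
  rw [edgeCount, Nat.card_eq_fintype_card, SimpleGraph.edgeFinset_card]

lemma deg_eq_degree {V : Type*} (G : SimpleGraph V) (u : V) [Fintype (G.neighborSet u)] :
    deg G u = G.degree u := by
  rw [deg, Nat.card_eq_fintype_card, SimpleGraph.card_neighborSet_eq_degree]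

lemma two_mul_turanEdges {r : ℕ} (hr : 0 < r) (n : ℕ) :
    (2 * turanEdges r n : ℤ) =
      (n : ℤ) ^ 2 - ((2 * (n / r : ℕ) + 1) * n - r * (n / r : ℕ) * ((n / r : ℕ) + 1)) := by
  classical
  rw [turanEdges, edgeCount_eq_card_edgeFinset, SimpleGraph.card_edgeFinset_turanGraph]
  have hn := Nat.div_add_mod n r
  generalize n / r = q at *
  generalize n % r = s at *
  obtain ⟨k, rfl⟩ : ∃ k, r = k + 1 := ⟨r - 1, by omega⟩
  subst hn
  obtain ⟨a, ha⟩ := (Nat.even_mul_succ_self k).two_dvd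
  have h₁ : ((((k + 1) * q + s) ^ 2 - s ^ 2) * (k + 1 - 1)) / (2 * (k + 1)) =
      q ^ 2 * a + s * q * k := by
    have h : ((k + 1) * q + s) ^ 2 - s ^ 2 = (k + 1) * q * ((k + 1) * q + 2 * s) := by
      rw [Nat.sub_eq_iff_eq_add (by gcongr; omega)]; ring
    rw [h, Nat.add_sub_cancel]
    refine Nat.div_eq_of_eq_mul_right (by positivity) ?_
    calc _ = (k + 1) * (q ^ 2 * (k * (k + 1)) + 2 * (s * q * k)) := by ring
      _ = _ := by rw [← Nat.succ_eq_add_one k, ha]; ring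
  have h₂ : (2 * (s.choose 2 : ℕ) : ℤ) = s * (s - 1) := by
    rcases s with _ | s
    · simp
    · have h := Nat.add_one_mul_choose_eq s 1
      simp at h
      push_cast
      zify at h
      linarith
  rw [h₁]
  zify at ha
  push_cast at ha ⊢
  linear_combination h₂ - q ^ 2 * ha

/-- Twice the number of edges of a complete `r`-partite graph with class sizes `c i` is at most
twice the number of edges of the Turán graph. -/
lemma sum_mul_sub_le_two_mul_turanEdges {r : ℕ} (hr : 0 < r) (n : ℕ) (c : Fin r → ℤ)
    (hc : ∑ i, c i = n) : ∑ i, c i * (n - c i) ≤ 2 * turanEdges r n := by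
  rw [two_mul_turanEdges hr]
  generalize n / r = q
  have h : 0 ≤ ∑ i, (c i - q) * (c i - (q + 1)) := by
    refine sum_nonneg fun i _ => ?_
    rcases le_or_gt (c i) q with h | h
    · exact mul_nonneg_of_nonpos_of_nonpos (by omega) (by omega)
    · exact mul_nonneg (by omega) (by omega)
  have h₁ : ∑ i, (c i - q) * (c i - (q + 1)) =
      ∑ i, c i ^ 2 - (2 * q + 1) * ∑ i, c i + r * (q * (q + 1)) := by
    rw [mul_sum, ← sum_sub_distrib]
    have : (r * (q * (q + 1)) : ℤ) = ∑ _i : Fin r, (q * (q + 1) : ℤ) := by simp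
    rw [this, ← sum_add_distrib]
    exact sum_congr rfl fun i _ => by ring
  have h₂ : ∑ i, c i * (n - c i) = n * ∑ i, c i - ∑ i, c i ^ 2 := by
    rw [mul_sum, ← sum_sub_distrib]
    exact sum_congr rfl fun i _ => by ring
  rw [h₂]
  rw [h₁] at h
  rw [hc] at *
  nlinarith

lemma mul_le_sum_of_two_mul_turanEdges_le {k n : ℕ} (c d : Fin (k + 1) → ℤ)
    (hc : ∑ i, c i = n) (hc₁ : ∀ i, 1 ≤ c i) (hdn : ∀ i, d i < n)
    (hd : ∀ i, d (Fin.last k) ≤ d i) (hcd : ∀ i, i ≠ Fin.last k → c i + d i ≤ n)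
    (h : (2 * turanEdges (k + 1) n : ℤ) ≤ ∑ i, c i * d i) :
    (k * n : ℤ) ≤ ∑ i, d i := by
  by_contra! hlt
  have he : ∑ i, ((n : ℤ) - d i) = (k + 1) * n - ∑ i, d i := by
    simp
  obtain ⟨c', hac, hce, hc'⟩ := exists_between_sum_eq univ (fun i => min (c i) (n - d i))
    (fun i => n - d i) (fun i => min_le_right _ _) n
    (hc ▸ sum_le_sum fun i _ => min_le_left _ _) (by rw [he]; linarith)
  have hc'₁ : ∀ i, 1 ≤ c' i := fun i =>
    (le_min (hc₁ i) (by have := hdn i; omega)).trans (hac i)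
  have hshift : ∑ i, c i * d i ≤ ∑ i, c' i * d i := by
    have h₀ : 0 ≤ ∑ i, (c' i - c i) * (d i - d (Fin.last k)) := by
      refine sum_nonneg fun i _ => ?_
      by_cases hi : i = Fin.last k
      · simp [hi]
      · have h₁ := hcd i hi
        have h₂ := hac i
        rw [min_eq_left (by omega)] at h₂
        exact mul_nonneg (by omega) (sub_nonneg.2 (hd i))
    have h₁ : ∑ i, (c' i - c i) * (d i - d (Fin.last k)) = ∑ i, c' i * d i - ∑ i, c i * d i
        - (∑ i, c' i - ∑ i, c i) * d (Fin.last k) := by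
      rw [← sum_sub_distrib, ← sum_sub_distrib, sum_mul, ← sum_sub_distrib]
      exact sum_congr rfl fun i _ => by ring
    rw [hc, hc'] at h₁
    linarith
  have hT := sum_mul_sub_le_two_mul_turanEdges k.succ_pos n c' hc'
  have hsum : ∑ i, ((n : ℤ) - d i - c' i) ≤ ∑ i, (c' i * (n - c' i) - c' i * d i) := by
    refine sum_le_sum fun i _ => ?_
    nlinarith [hc'₁ i, hce i]
  rw [sum_sub_distrib, he, hc', sum_sub_distrib] at hsum
  simp only [Nat.succ_eq_add_one] at hT
  linarith

lemma mul_le_mul_sum_of_le_sum_mul {k n : ℕ} {M : ℤ} (c d : Fin (k + 1) → ℤ)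
    (hc : ∑ i, c i = n) (hd : ∀ i, d (Fin.last k) ≤ d i)
    (hcd : ∀ i, i ≠ Fin.last k → c i + d i ≤ n) (hM : M ≤ ∑ i, c i * d i)
    (h : (k * n : ℤ) ≤ ∑ i, d i) : (k + 1) * M ≤ n * ∑ i, d i := by
  have h₁ : ∑ i, c i * (d i - d (Fin.last k)) ≤ ∑ i, (n - d i) * (d i - d (Fin.last k)) := by
    refine sum_le_sum fun i _ => ?_
    by_cases hi : i = Fin.last k
    · simp [hi]
    · exact mul_le_mul_of_nonneg_right (by have := hcd i hi; omega) (sub_nonneg.2 (hd i))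
  have h₂ : ∑ i, c i * (d i - d (Fin.last k)) = ∑ i, c i * d i - n * d (Fin.last k) := by
    rw [← hc, sum_mul, ← sum_sub_distrib]
    exact sum_congr rfl fun i _ => by ring
  have h₃ : ∑ i, (n - d i) * (d i - d (Fin.last k)) =
      (n + d (Fin.last k)) * ∑ i, d i - ∑ i, d i ^ 2 - (k + 1) * (n * d (Fin.last k)) := by
    have : ((k + 1) * (n * d (Fin.last k)) : ℤ) =
      ∑ _i : Fin (k + 1), (n * d (Fin.last k) : ℤ) := by simp
    rw [this, mul_sum, ← sum_sub_distrib, ← sum_sub_distrib]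
    exact sum_congr rfl fun i _ => by ring
  have h₄ : (k + 1) * d (Fin.last k) ≤ ∑ i, d i := by
    calc _ = ∑ _i : Fin (k + 1), d (Fin.last k) := by simp
      _ ≤ _ := sum_le_sum fun i _ => hd i
  have h₅ : (∑ i, d i) ^ 2 ≤ (k + 1) * ∑ i, d i ^ 2 := by
    simpa using sq_sum_le_card_mul_sum_sq (s := univ) (f := d)
  rw [h₂, h₃] at h₁
  have h₆ := mul_le_mul_of_nonneg_right h₄ (sub_nonneg.2 h)
  have h₇ := mul_le_mul_of_nonneg_left (hM.trans (sub_le_iff_le_add.1 h₁))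
    (by positivity : (0 : ℤ) ≤ k + 1)
  linarith

/-- Each vertex gets the index of the first term it is not adjacent to, and the last index if it
is adjacent to all terms but possibly the last. -/
lemma exists_first_nonadj {V : Type*} (G : SimpleGraph V) {k : ℕ} (v : Fin (k + 1) → V) (u : V) :
    ∃ i, (∀ j < i, G.Adj (v j) u) ∧ (i ≠ Fin.last k → ¬ G.Adj (v i) u) := by
  have hne : ∃ i, i = Fin.last k ∨ ¬ G.Adj (v i) u := ⟨_, Or.inl rfl⟩
  obtain ⟨i, hi, hmin⟩ := WellFounded.has_min (wellFounded_lt (α := Fin (k + 1)))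
    {i | i = Fin.last k ∨ ¬ G.Adj (v i) u} hne
  refine ⟨i, fun j hj => ?_, fun h => hi.resolve_left h⟩
  by_contra hadj
  exact hmin j (Or.inr hadj) hj

/-- If r ≥ 2, n ≥ r, and G is a graph with n vertices and m ≥ t_r(n)
edges, then every 𝔓-sequence of r terms has degree sum at least 2·r·m/n. -/
theorem pseq_degree_sum_ge_avg (r n m : ℕ) (hr : 2 ≤ r) (hn : r ≤ n)
    (G : SimpleGraph (Fin n)) (hm : edgeCount G = m) (hmt : turanEdges r n ≤ m)
    (v : Fin r → Fin n) (hP : IsPSeq G v) :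
    (2 * r * m : ℝ) / n ≤ ∑ i, (deg G (v i) : ℝ) := by
  classical
  obtain ⟨k, rfl⟩ : ∃ k, r = k + 1 := ⟨r - 1, by omega⟩
  choose f hf hf' using exists_first_nonadj G v
  have hfv : ∀ i, f (v i) = i := fun i => by
    have hle : f (v i) ≤ i := le_of_not_gt fun h => G.loopless.irrefl _ (hf (v i) i h)
    refine hle.eq_of_not_lt fun hlt => ?_
    exact hf' (v i) (hlt.trans_le (Fin.le_last i)).ne ((hP i).1 _ hlt)
  let c : Fin (k + 1) → ℤ := fun i => #{u | f u = i}
  let d : Fin (k + 1) → ℤ := fun i => deg G (v i)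
  have hc : ∑ i, c i = n := by
    have := card_eq_sum_card_fiberwise (f := f) (s := univ) (t := univ) (by simp)
    simp only [card_univ, Fintype.card_fin] at this
    simp only [c]
    exact_mod_cast this.symm
  have hc₁ : ∀ i, 1 ≤ c i := fun i => by
    have : 0 < #{u | f u = i} := card_pos.2 ⟨v i, by simp [hfv]⟩
    simp only [c]
    exact_mod_cast this
  have hdn : ∀ i, d i < n := fun i => by
    have := G.degree_lt_card_verts (v i)
    rw [Fintype.card_fin, ← deg_eq_degree] at this
    simp only [d]
    exact_mod_cast this
  have hd : ∀ i, d (Fin.last k) ≤ d i := fun i => by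
    have := (hP i).2 (v (Fin.last k)) fun j hj =>
      (hP (Fin.last k)).1 j (hj.trans_le (Fin.le_last i))
    simp only [d]
    exact_mod_cast this
  have hcd : ∀ i, i ≠ Fin.last k → c i + d i ≤ n := fun i hi => by
    have hdisj : Disjoint ({u | f u = i} : Finset (Fin n)) (G.neighborFinset (v i)) := by
      rw [disjoint_left]
      intro u hu hadj
      simp only [mem_filter, mem_univ, true_and] at hu
      subst hu
      exact hf' u hi ((G.mem_neighborFinset _ _).1 hadj)
    have := card_le_univ (({u | f u = i} : Finset (Fin n)) ∪ G.neighborFinset (v i))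
    rw [card_union_of_disjoint hdisj, Fintype.card_fin, G.card_neighborFinset_eq_degree,
      ← deg_eq_degree] at this
    simp only [c, d]
    exact_mod_cast this
  have hM : (2 * m : ℤ) ≤ ∑ i, c i * d i := by
    have h₁ := G.sum_degrees_eq_twice_card_edges
    rw [← edgeCount_eq_card_edgeFinset, hm] at h₁
    have h₂ : ∑ u, G.degree u ≤ ∑ u, deg G (v (f u)) :=
      sum_le_sum fun u _ => (deg_eq_degree G u).symm.trans_le ((hP (f u)).2 u (hf u))
    have h₃ : ∑ u, deg G (v (f u)) = ∑ i, #{u | f u = i} * deg G (v i) := by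
      rw [← sum_fiberwise univ f]
      refine sum_congr rfl fun i _ => ?_
      rw [← smul_eq_mul, ← sum_const]
      exact sum_congr rfl fun u hu => by rw [(mem_filter.1 hu).2]
    rw [h₁, h₃] at h₂
    simp only [c, d]
    exact_mod_cast h₂
  have hT : (2 * turanEdges (k + 1) n : ℤ) ≤ 2 * m := by exact_mod_cast Nat.mul_le_mul_left 2 hmt
  have hS := mul_le_sum_of_two_mul_turanEdges_le c d hc hc₁ hdn hd hcd (hT.trans hM)
  have hmain := mul_le_mul_sum_of_le_sum_mul c d hc hd hcd hM hS
  have hmain' : ((k + 1) * (2 * m) : ℝ) ≤ n * ∑ i, (deg G (v i) : ℝ) := by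
    simp only [d] at hmain
    exact_mod_cast hmain
  have hn₀ : (0 : ℝ) < n := by exact_mod_cast (by omega : 0 < n)
  rw [div_le_iff₀ hn₀]
  push_cast
  linarith
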